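/- arXiv:2202.08123 — 2 statements merged into one kernel-verified Lean document; each statement's English description precedes it below -/
import Mathlib

section
/- Let s, t > 0 be real numbers and let G = (V, E) be a finite simple graph with V nonempty such that ‖V‖ ≥ (s + t + 1)·|V|. Then there exists a partition (A, B) of V with both A and B nonempty such that ‖A‖ ≥ s·|A| and ‖B‖ ≥ t·|B|. -/
open Finset

/-- `G.edgesIn X` is the number of edges of the induced subgraph `G[X]`,
i.e. the number of edges of `G` with both endpoints in `X`. -/
noncomputable def SimpleGraph.edgesIn {V : Type*} (G : SimpleGraph V) (X : Finset V) : ℕ :=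
  {e ∈ G.edgeSet | ∀ v ∈ e, v ∈ X}.ncard

namespace SimpleGraph

variable {V : Type*} (G : SimpleGraph V)

open Classical in
/-- The number of neighbours of `u` in `X`, as a real number. -/
noncomputable def degIn (X : Finset V) (u : V) : ℝ :=
  ∑ w ∈ X, if G.Adj u w then 1 else 0

lemma degIn_singleton_self (u : V) : G.degIn {u} u = 0 := by
  simp [degIn]

lemma sum_degIn_comm (X Y : Finset V) :
    ∑ u ∈ X, G.degIn Y u = ∑ u ∈ Y, G.degIn X u := by
  simp only [degIn]
  rw [sum_comm]
  exact sum_congr rfl fun _ _ => sum_congr rfl fun _ _ => by rw [G.adj_comm]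

lemma sum_degIn_singleton (X : Finset V) (v : V) :
    ∑ u ∈ X, G.degIn {v} u = G.degIn X v := by
  rw [sum_degIn_comm, sum_singleton]

lemma degIn_le_card (X : Finset V) (u : V) : G.degIn X u ≤ X.card := by
  classical
  simp only [degIn, sum_boole]
  exact_mod_cast card_filter_le _ _

lemma degIn_insert [DecidableEq V] {X : Finset V} {v : V} (hv : v ∉ X) (u : V) :
    G.degIn (insert v X) u = G.degIn {v} u + G.degIn X u := by
  simp only [degIn, sum_insert hv, sum_singleton]

variable [Fintype V]

lemma two_mul_edgesIn (X : Finset V) :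
    2 * (G.edgesIn X : ℝ) = ∑ u ∈ X, G.degIn X u := by
  classical
  let H : SimpleGraph V :=
    { Adj := fun u w => G.Adj u w ∧ u ∈ X ∧ w ∈ X
      symm := ⟨fun u w h => ⟨h.1.symm, h.2.2, h.2.1⟩⟩
      loopless := ⟨fun u h => G.loopless.irrefl u h.1⟩ }
  have hE : {e ∈ G.edgeSet | ∀ v ∈ e, v ∈ X} = (H.edgeFinset : Set (Sym2 V)) := by
    ext e
    induction e with
    | _ u w => simp [H]
  have hdeg (u : V) : (H.degree u : ℝ) = if u ∈ X then G.degIn X u else 0 := by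
    rw [← card_neighborFinset_eq_degree, neighborFinset_eq_filter]
    split_ifs with hu
    · simp only [degIn, sum_boole, H]
      congr 2
      ext w
      simp [hu, and_comm]
    · simp [H, hu]
  have hsum := H.sum_degrees_eq_twice_card_edges
  rw [edgesIn, hE, Set.ncard_coe_finset]
  have : (∑ v, (H.degree v : ℝ)) = 2 * (H.edgeFinset.card : ℝ) := by exact_mod_cast hsum
  rw [← this]
  simp [hdeg]

lemma edgesIn_empty : (G.edgesIn ∅ : ℝ) = 0 := by
  have := G.two_mul_edgesIn ∅
  simpa using this

variable [DecidableEq V]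

lemma degIn_add_degIn_compl (X : Finset V) (u : V) :
    G.degIn X u + G.degIn Xᶜ u = G.degIn univ u :=
  sum_add_sum_compl X _

lemma edgesIn_insert {X : Finset V} {v : V} (hv : v ∉ X) :
    (G.edgesIn (insert v X) : ℝ) = G.edgesIn X + G.degIn X v := by
  have h1 := G.two_mul_edgesIn (insert v X)
  have h2 := G.two_mul_edgesIn X
  simp only [sum_insert hv, G.degIn_insert hv, sum_add_distrib, degIn_singleton_self,
    sum_degIn_singleton] at h1
  linarith

lemma edgesIn_erase {X : Finset V} {v : V} (hv : v ∈ X) :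
    (G.edgesIn X : ℝ) = G.edgesIn (X.erase v) + G.degIn X v := by
  have h := G.edgesIn_insert (notMem_erase v X)
  have h' := G.degIn_insert (notMem_erase v X) v
  rw [insert_erase hv] at h h'
  rw [h, h', degIn_singleton_self, zero_add]

lemma edgesIn_le_edgesIn_erase_add {X : Finset V} {v : V} (hv : v ∈ X) :
    (G.edgesIn X : ℝ) ≤ G.edgesIn (X.erase v) + (X.card - 1) := by
  have h := G.edgesIn_insert (notMem_erase v X)
  have h' := G.degIn_le_card (X.erase v) v
  rw [insert_erase hv] at h
  rw [cast_card_erase_of_mem hv] at h'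
  linarith

lemma edgesIn_univ (X : Finset V) :
    (G.edgesIn univ : ℝ) = G.edgesIn X + G.edgesIn Xᶜ + ∑ u ∈ X, G.degIn Xᶜ u := by
  have h := G.two_mul_edgesIn univ
  have h1 := G.two_mul_edgesIn X
  have h2 := G.two_mul_edgesIn Xᶜ
  have h3 := G.sum_degIn_comm X Xᶜ
  rw [← sum_add_sum_compl X] at h
  simp only [← G.degIn_add_degIn_compl X, sum_add_distrib] at h
  linarith

/-- If `‖A‖/(|A|-1) + ‖B‖/|B| ≥ c` holds for a partition `(A, B)` of a graph with
`‖V‖ ≥ c|V|`, then it still holds after moving a suitable vertex from `A` to `B`. -/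
lemma exists_mem_erase_edgesIn_ge {c : ℝ}
    (h : c * (Fintype.card V : ℝ) ≤ (G.edgesIn univ : ℝ)) {A : Finset V} (hA : 2 < A.card)
    (hinv : c * ((A.card - 1) * Aᶜ.card) ≤
      (Aᶜ.card : ℝ) * G.edgesIn A + (A.card - 1) * G.edgesIn Aᶜ) :
    ∃ u ∈ A, c * (((A.erase u).card - 1) * (A.erase u)ᶜ.card) ≤
      ((A.erase u)ᶜ.card : ℝ) * G.edgesIn (A.erase u) +
        ((A.erase u).card - 1) * G.edgesIn (A.erase u)ᶜ := by
  have hne : A.Nonempty := card_pos.mp (by omega)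
  have hA' : (2 : ℝ) < A.card := by exact_mod_cast hA
  have hn : (Fintype.card V : ℝ) = A.card + Aᶜ.card := by
    exact_mod_cast (card_add_card_compl A).symm
  by_contra! hcon
  have key : ∀ u ∈ A, ((Aᶜ.card : ℝ) + 1) * (G.edgesIn A - G.degIn A u) +
      (A.card - 2) * (G.edgesIn Aᶜ + G.degIn Aᶜ u) <
      c * ((A.card - 2) * (Aᶜ.card + 1)) := by
    intro u hu
    have hu' : u ∉ Aᶜ := by simpa using hu
    have := hcon u hu
    rw [compl_erase, G.edgesIn_insert hu', card_insert_of_notMem hu',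
      cast_card_erase_of_mem hu] at this
    push_cast at this
    have he := G.edgesIn_erase hu
    rw [show (G.edgesIn A : ℝ) - G.degIn A u = G.edgesIn (A.erase u) by linarith]
    linarith
  have hsum := sum_lt_sum_of_nonempty hne key
  simp only [sum_add_distrib, ← mul_sum, sum_sub_distrib, sum_const, nsmul_eq_mul,
    ← G.two_mul_edgesIn A] at hsum
  have hE := G.edgesIn_univ A
  rw [hE, hn] at h
  set a : ℝ := (A.card : ℝ)
  set b : ℝ := (Aᶜ.card : ℝ)
  set x : ℝ := (G.edgesIn A : ℝ)
  set y : ℝ := (G.edgesIn Aᶜ : ℝ)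
  set z := ∑ u ∈ A, G.degIn Aᶜ u
  nlinarith [mul_le_mul_of_nonneg_left h (by linarith : 0 ≤ a - 2),
    mul_le_mul_of_nonneg_left hinv (by linarith : 0 ≤ a - 2)]

end SimpleGraph

/-- Every graph with `‖V‖ ≥ (s+t+1)|V|` has a partition into nonempty parts `A`, `B`
with `‖A‖ ≥ s|A|` and `‖B‖ ≥ t|B|`. -/
theorem avg_degree_partition {V : Type*} [Fintype V] [Nonempty V] [DecidableEq V]
    (G : SimpleGraph V) (s t : ℝ) (hs : 0 < s) (ht : 0 < t)
    (h : (s + t + 1) * (Fintype.card V : ℝ) ≤ (G.edgesIn Finset.univ : ℝ)) :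
    ∃ A B : Finset V, A.Nonempty ∧ B.Nonempty ∧ Disjoint A B ∧ A ∪ B = Finset.univ ∧
      s * (A.card : ℝ) ≤ (G.edgesIn A : ℝ) ∧ t * (B.card : ℝ) ≤ (G.edgesIn B : ℝ) := by
  classical
  let F : Finset (Finset V) := {A | A.Nonempty ∧ s * (A.card : ℝ) ≤ G.edgesIn A ∧
    (s + t + 1) * ((A.card - 1) * Aᶜ.card) ≤
      (Aᶜ.card : ℝ) * G.edgesIn A + (A.card - 1) * G.edgesIn Aᶜ}
  have hV : univ ∈ F := by
    have : 0 ≤ (t + 1) * (Fintype.card V : ℝ) := by positivity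
    simp only [F, mem_filter_univ, univ_nonempty, card_univ, compl_univ, card_empty,
      G.edgesIn_empty, true_and]
    constructor
    · linarith
    · simp
  obtain ⟨A, hAF, hmin⟩ := F.exists_min_image card ⟨_, hV⟩
  simp only [F, mem_filter_univ] at hAF hmin
  obtain ⟨hne, hf, hinv⟩ := hAF
  by_contra hcon
  have hg : Aᶜ.Nonempty → (G.edgesIn Aᶜ : ℝ) < t * Aᶜ.card := fun hB => by
    by_contra! hg
    exact hcon ⟨A, Aᶜ, hne, hB, disjoint_compl_right, union_compl A, hf, hg⟩
  have ha : (1 : ℝ) ≤ A.card := by exact_mod_cast hne.card_pos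
  have herase : ∀ u ∈ A, s * ((A.erase u).card : ℝ) ≤ G.edgesIn (A.erase u) := by
    intro u hu
    by_contra! hlt
    have hle := G.edgesIn_le_edgesIn_erase_add hu
    rw [cast_card_erase_of_mem hu] at hlt
    have hlt' : (G.edgesIn A : ℝ) < (s + 1) * (A.card - 1) := by linarith
    rcases Aᶜ.eq_empty_or_nonempty with hB | hB
    · obtain rfl : A = univ := by simpa using hB
      rw [card_univ] at hlt' ha
      nlinarith
    · have hb : (0 : ℝ) < Aᶜ.card := by exact_mod_cast hB.card_pos
      nlinarith [mul_lt_mul_of_pos_left hlt' hb,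
        mul_le_mul_of_nonneg_left (hg hB).le (by linarith : (0 : ℝ) ≤ A.card - 1)]
  have hsingle (v : V) : (G.edgesIn {v} : ℝ) < s * ({v} : Finset V).card := by
    have := G.edgesIn_insert (notMem_empty v)
    simp [G.edgesIn_empty, SimpleGraph.degIn] at this
    simpa [this] using hs
  have hcard1 : A.card ≠ 1 := fun h1 => by
    obtain ⟨v, rfl⟩ := card_eq_one.mp h1
    exact absurd hf (hsingle v).not_ge
  have hcard2 : A.card ≠ 2 := fun h2 => by
    obtain ⟨u, hu⟩ := hne
    obtain ⟨v, hv⟩ := card_eq_one.mp (by rw [card_erase_of_mem hu, h2] : (A.erase u).card = 1)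
    have := herase u hu
    rw [hv] at this
    exact absurd this (hsingle v).not_ge
  have hcard : 2 < A.card := by
    have := hne.card_pos
    omega
  obtain ⟨u, hu, hinv'⟩ := G.exists_mem_erase_edgesIn_ge h hcard hinv
  have hpos : (A.erase u).Nonempty := card_pos.mp (by rw [card_erase_of_mem hu]; omega)
  exact absurd (hmin _ ⟨hpos, herase u hu, hinv'⟩) (card_erase_lt_of_mem hu).not_ge
end

section
/- Let s, t be real numbers with s, t > 1/2. If G = (V, E) is a finite simple graph with V nonempty satisfying ‖V‖ − (s + t + 1)·|V| ≥ 0, then there exist disjoint nonempty sets A, B ⊆ V such that (1) ‖A‖ − s·|A| ≥ 0; (2) ‖B‖ − t·|B| ≥ 0; and (3) (‖A‖ − s·|A|) + (‖B‖ − t·|B|) ≥ T(A ∪ B) − 1. -/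
open Finset

section ExcessBasics

variable {V : Type*}

open Classical in
/-- The adjacency indicator of `G`, as a real number. -/
noncomputable def adjInd (G : SimpleGraph V) (u v : V) : ℝ := if G.Adj u v then 1 else 0

/-- The number of neighbours of `u` inside `A`. -/
noncomputable def degIn (G : SimpleGraph V) (A : Finset V) (u : V) : ℝ := ∑ v ∈ A, adjInd G u v

/-- The excess `‖A‖ - s|A|`, with `‖A‖` written as half of the sum of the inner degrees. -/
noncomputable def excess (G : SimpleGraph V) (s : ℝ) (A : Finset V) : ℝ :=
  (∑ u ∈ A, degIn G A u) / 2 - s * A.card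

variable (G : SimpleGraph V)

lemma adjInd_comm (u v : V) : adjInd G u v = adjInd G v u := by
  by_cases h : G.Adj u v
  · simp [adjInd, h, h.symm]
  · simp [adjInd, h, mt (fun h' : G.Adj v u => h'.symm) h]

@[simp] lemma adjInd_self (u : V) : adjInd G u u = 0 := by simp [adjInd]

lemma adjInd_eq (u v : V) : adjInd G u v = 0 ∨ adjInd G u v = 1 := by
  unfold adjInd; split_ifs <;> simp

lemma adjInd_nonneg (u v : V) : 0 ≤ adjInd G u v := by
  rcases adjInd_eq G u v with h | h <;> simp [h]

lemma adjInd_le_one (u v : V) : adjInd G u v ≤ 1 := by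
  rcases adjInd_eq G u v with h | h <;> simp [h]

lemma degIn_nonneg (A : Finset V) (u : V) : 0 ≤ degIn G A u :=
  sum_nonneg fun _ _ => adjInd_nonneg G _ _

lemma degIn_le_card (A : Finset V) (u : V) : degIn G A u ≤ A.card := by
  have := sum_le_sum (s := A) fun v _ => adjInd_le_one G u v
  simpa [degIn] using this

@[simp] lemma degIn_empty (u : V) : degIn G ∅ u = 0 := by simp [degIn]

@[simp] lemma excess_empty (s : ℝ) : excess G s ∅ = 0 := by simp [excess]

lemma sum_degIn (s : ℝ) (A : Finset V) :
    ∑ u ∈ A, degIn G A u = 2 * excess G s A + 2 * s * A.card := by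
  unfold excess; ring

lemma sum_degIn_comm (A B : Finset V) : ∑ u ∈ A, degIn G B u = ∑ w ∈ B, degIn G A w := by
  unfold degIn
  rw [sum_comm]
  exact sum_congr rfl fun _ _ => sum_congr rfl fun _ _ => adjInd_comm G _ _

variable [DecidableEq V]

lemma degIn_insert {A : Finset V} {v : V} (hv : v ∉ A) (u : V) :
    degIn G (insert v A) u = degIn G A u + adjInd G u v := by
  unfold degIn; rw [sum_insert hv]; ring

lemma degIn_erase {A : Finset V} {v : V} (hv : v ∈ A) (u : V) :
    degIn G (A.erase v) u = degIn G A u - adjInd G u v := by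
  have := degIn_insert G (notMem_erase v A) u
  rw [insert_erase hv] at this
  linarith

lemma degIn_union {A B : Finset V} (h : Disjoint A B) (u : V) :
    degIn G (A ∪ B) u = degIn G A u + degIn G B u := by
  unfold degIn; rw [sum_union h]

lemma degIn_le_card_sub_one {A : Finset V} {u : V} (hu : u ∈ A) :
    degIn G A u ≤ A.card - 1 := by
  have h1 := degIn_erase G hu u
  have h2 := degIn_le_card G (A.erase u) u
  rw [card_erase_of_mem hu, Nat.cast_sub (card_pos.2 ⟨u, hu⟩)] at h2
  simp only [adjInd_self, Nat.cast_one] at h1 h2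
  linarith

lemma excess_insert (s : ℝ) {A : Finset V} {v : V} (hv : v ∉ A) :
    excess G s (insert v A) = excess G s A + (degIn G A v - s) := by
  unfold excess
  rw [sum_insert hv, card_insert_of_notMem hv, degIn_insert G hv]
  simp only [degIn_insert G hv, sum_add_distrib, adjInd_self]
  have : ∑ x ∈ A, adjInd G x v = degIn G A v := sum_congr rfl fun _ _ => adjInd_comm G _ _
  rw [this]; push_cast; ring

lemma excess_erase (s : ℝ) {A : Finset V} {v : V} (hv : v ∈ A) :
    excess G s (A.erase v) = excess G s A - (degIn G A v - s) := by
  have := excess_insert G s (notMem_erase v A)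
  rw [insert_erase hv, degIn_erase G hv v] at this
  simp only [adjInd_self] at this
  linarith

lemma excess_union (s t : ℝ) {A B : Finset V} (h : Disjoint A B) :
    excess G (s + t) (A ∪ B) = excess G s A + excess G t B + ∑ u ∈ A, degIn G B u
      - t * A.card - s * B.card := by
  have h1 := sum_degIn_comm G A B
  unfold excess
  rw [sum_union h, card_union_of_disjoint h]
  simp only [degIn_union G h, sum_add_distrib]
  rw [← h1]; push_cast; ring

/-- A set of nonnegative excess `φ` all of whose inner degrees exceed `s + φ` satisfies
`2φ < |A|` and `φ < s + 1`. -/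
lemma excess_small {s : ℝ} (hs : 0 < s) {A : Finset V} (hA : A.Nonempty)
    (h0 : 0 ≤ excess G s A) (hd : ∀ w ∈ A, s + excess G s A < degIn G A w) :
    2 * excess G s A < A.card ∧ excess G s A < s + 1 ∧
      s * A.card + 2 * excess G s A ≤ A.card * A.card / 2 := by
  have h1 := sum_degIn G s A
  have h2 : ∑ w ∈ A, (s + excess G s A) < ∑ w ∈ A, degIn G A w := sum_lt_sum_of_nonempty hA hd
  have h3 : ∑ w ∈ A, degIn G A w ≤ ∑ w ∈ A, ((A.card : ℝ) - 1) :=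
    sum_le_sum fun w hw => degIn_le_card_sub_one G hw
  rw [sum_const, nsmul_eq_mul] at h2 h3
  have h4 : (1 : ℝ) ≤ A.card := by exact_mod_cast card_pos.2 hA
  obtain ⟨w, hw⟩ := hA
  have h5 := hd w hw
  have h6 := degIn_le_card_sub_one G hw
  rw [h1] at h2 h3
  generalize (A.card : ℝ) = a at *
  generalize excess G s A = φ at *
  have h8 : 2 * φ < a := by
    by_contra hc
    push Not at hc
    nlinarith
  refine ⟨h8, ?_, ?_⟩
  · by_contra hc
    push Not at hc
    nlinarith
  · rcases le_total a (2 * s + 2) with h | h <;> nlinarith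

end ExcessBasics

section RealInequalities

lemma div_le_div_of_gauge_le {α β p q α' β' : ℝ} (hα : 0 < α) (hβ : 0 < β) (hq : 0 < q)
    (hp : p ≤ α) (hα' : 0 < α') (hβ' : 0 < β')
    (h : (α' + β') * (1 - (p - α + α') / α' - q / β') ≤ (α + β) * (1 - p / α - q / β)) :
    α * β' ≤ β * α' := by
  by_contra hc
  push Not at hc
  have e1 : (α' + β') * (1 - (p - α + α') / α' - q / β')
      = (1 + β' / α') * (α - p) - q * (1 + α' / β') := by field_simp; ring
  have e2 : (α + β) * (1 - p / α - q / β) = (1 + β / α) * (α - p) - q * (1 + α / β) := by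
    field_simp; ring
  rw [e1, e2] at h
  have h1 : β / α < β' / α' := by
    rw [div_lt_div_iff₀ hα hα']; linarith
  have h2 : α' / β' < α / β := by
    rw [div_lt_div_iff₀ hβ' hβ]; linarith
  nlinarith [mul_nonneg (sub_nonneg.2 h1.le) (sub_nonneg.2 hp), mul_pos hq (sub_pos.2 h2)]

lemma le_of_theta_le {α β p q a b : ℝ} (hα : 0 < α) (hβ : 0 < β)
    (h : p / α + q / β ≤ (p + a) / α + (q - b) / β) : α * b ≤ β * a := by
  have e : (p + a) / α + (q - b) / β = p / α + q / β + (a / α - b / β) := by ring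
  have : b / β ≤ a / α := by linarith
  rw [div_le_div_iff₀ hβ hα] at this
  linarith

lemma le_of_theta_le_shift {α β p q a b : ℝ} (hα : 0 < α) (hβ : 0 < β) (hp : 0 < p) (hq : 0 < q)
    (ha : 0 < p + a) (hb : 0 < q - b)
    (h : 1 < α → p / α + q / β ≤ (p + a) / (α - 1) + (q - b) / (β + 1)) :
    α * b ≤ β * (a + (p / α + q / β)) := by
  have key : (α / β) * b ≤ a + (p / α + q / β) := by
    have e : (p / α + q / β) * α = p + α / β * q := by field_simp
    rcases lt_or_ge 1 α with h1 | h1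
    · have h2 := mul_le_mul_of_nonneg_right (h h1) (by linarith : 0 ≤ α - 1)
      have e2 : ((p + a) / (α - 1) + (q - b) / (β + 1)) * (α - 1)
          = p + a + (α - 1) / (β + 1) * (q - b) := by
        have : α - 1 ≠ 0 := by linarith
        field_simp
      have h3 : (α - 1) / (β + 1) ≤ α / β := by
        rw [div_le_div_iff₀ (by linarith) hβ]; nlinarith
      have h4 := mul_le_mul_of_nonneg_right h3 hb.le
      nlinarith
    · have h2 : α / β * q ≤ q / β := by
        rw [div_mul_eq_mul_div]
        gcongr
        nlinarith
      have h3 : p ≤ p / α := by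
        rw [le_div_iff₀ hα]; nlinarith
      have h4 := mul_pos (div_pos hα hβ) hb
      nlinarith
  have := mul_le_mul_of_nonneg_left key hβ.le
  have e3 : β * (α / β * b) = α * b := by field_simp
  linarith

lemma bracket_le {s d z q ρ θ : ℝ} (hs : 0 < s) (hz : z ≤ d) (hq : 0 ≤ q) (hρ : 0 ≤ ρ)
    (hd : s < d) (hθ : ρ ≤ θ * (d - s)) (hθ1 : θ ≤ 1)
    (h : z * (d - 1 - ρ) ≤ 2 * s * (d + q) - 2 * ρ) :
    z * (1 - θ) + θ * s - ρ ≤ 1 + 2 * s + q := by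
  have hds : 0 < d - s := sub_pos.2 hd
  rcases le_total z s with hzs | hzs
  · nlinarith
  · obtain ⟨ξ, hξ⟩ : ∃ ξ, ρ = ξ * (d - s) := ⟨ρ / (d - s), by field_simp⟩
    have hξ0 : 0 ≤ ξ := by
      rw [hξ] at hρ; exact nonneg_of_mul_nonneg_left hρ hds
    have hξθ : ξ ≤ θ := by
      rw [hξ] at hθ; exact le_of_mul_le_mul_right hθ hds
    by_contra hc
    push Not at hc
    have h1 : 1 + 2 * s + q + ξ * (z + d - 2 * s) < z := by nlinarith
    have h2 : 0 ≤ ξ * (z + d - 2 * s) := mul_nonneg hξ0 (by linarith)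
    have h3 : 2 * s + 1 < z := by linarith
    have h4 : 0 < (z + d - 2 * s) * (d - 1) - (z - 2) * (d - s) := by
      have : (z + d - 2 * s) * (d - 1) - (z - 2) * (d - s)
        = z * (s - 1) + d * (d + 1 - 2 * s) := by ring
      rw [this]
      rcases le_total 1 s with h5 | h5
      · nlinarith
      · nlinarith
    have h5 : (1 + 2 * s + q + ξ * (z + d - 2 * s)) * (d - 1) ≤ z * (d - 1) :=
      mul_le_mul_of_nonneg_right h1.le (by linarith)
    have h6 : 0 ≤ ξ * ((z + d - 2 * s) * (d - 1) - (z - 2) * (d - s)) := mul_nonneg hξ0 h4.le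
    have h7 : 0 < (1 + q) * (d - 1 - 2 * s) := mul_pos (by linarith) (by linarith)
    subst hξ
    nlinarith

lemma bracket_le_of_degrees {s d z q p π θ : ℝ} (hs : 0 < s) (hz : z ≤ d) (hq : 0 ≤ q)
    (hp : 0 ≤ p) (hπ : 0 ≤ π) (hd : s < d) (hθ : p ≤ θ * (d - s)) (hθ1 : θ ≤ 1)
    (h : z * (d - 1 - p) + (d + q - z) * (s - 1) ≤ 2 * s * (d + q) - 2 * π) :
    z * (1 - θ) + θ * s - π ≤ 1 + 2 * s + q := by
  have hds : 0 < d - s := sub_pos.2 hd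
  rcases le_total z s with hzs | hzs
  · nlinarith
  · obtain ⟨ξ, hξ⟩ : ∃ ξ, p = ξ * (d - s) := ⟨p / (d - s), by field_simp⟩
    have hξ0 : 0 ≤ ξ := by
      rw [hξ] at hp; exact nonneg_of_mul_nonneg_left hp hds
    have hξθ : ξ ≤ θ := by
      rw [hξ] at hθ; exact le_of_mul_le_mul_right hθ hds
    by_contra hc
    push Not at hc
    have h1 : 1 + 2 * s + q + π + ξ * (z - s) < z := by nlinarith
    have h2 : 0 ≤ ξ * (z - s) := mul_nonneg hξ0 (by linarith)
    have h3 : 1 + s < z * (1 - ξ) := by nlinarith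
    have h4 : 2 * s + q + π + (d - z) * (1 - ξ) ≤ d - 1 - p := by
      subst hξ; nlinarith
    have h5 := mul_le_mul_of_nonneg_left h4 (by linarith : 0 ≤ z)
    have h6 : 0 ≤ (d - z) * (z * (1 - ξ) - s - 1) :=
      mul_nonneg (by linarith) (by linarith)
    have h7 : 0 ≤ q * (z - s - 1) := mul_nonneg hq (by linarith)
    have h8 : 0 ≤ π * (z + 2) := mul_nonneg hπ (by linarith)
    subst hξ
    nlinarith

lemma false_of_strict {s t α β Θ π q θ x y z w e : ℝ} (hs : 0 < s) (ht : 0 < t)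
    (hα : 0 < α) (hβ : 0 < β) (hΘ : 0 ≤ Θ) (hπ : 0 < π) (hq : 0 < q)
    (hθ : θ = (Θ + π) / α + q / β) (hx : s ≤ x) (hy : t ≤ y)
    (he : e = Θ + t * (α + x) + s * (β + y) + x + y + 1 + π + q)
    (h1 : α * (e - t * (α + x)) ≤ β * (-(2 * π) + s * (α + x) + z + θ * (α + s - z)))
    (h2 : β * (e - s * (β + y)) ≤ α * (-(2 * q) + t * (β + y) + w + θ * (β + t - w)))
    (k1 : z * (1 - θ) + θ * s - π ≤ 1 + s + x) (k2 : w * (1 - θ) + θ * t - q ≤ 1 + t + y)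
    (hαβ : Θ * β ≤ Θ * α) : False := by
  have hθ' : θ * α * β = (Θ + π) * β + q * α := by rw [hθ]; field_simp
  have H1 : α * ((1 + y) * (1 + s) + Θ) < β * ((1 + x) * (1 + s) + Θ) := by
    have := mul_le_mul_of_nonneg_left k1 hβ.le
    have := mul_pos hα hπ
    have := mul_nonneg hα.le (sub_nonneg.2 hx)
    subst he
    nlinarith
  have H2 : β * ((1 + x) * (1 + t)) < α * ((1 + y) * (1 + t)) := by
    have := mul_le_mul_of_nonneg_left k2 hα.le
    have := mul_pos hβ hq
    have := mul_nonneg hβ.le (sub_nonneg.2 hy)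
    have := mul_pos hβ hπ
    have := mul_nonneg hβ.le hΘ
    subst he
    nlinarith
  have H3 : β * (1 + x) < α * (1 + y) := by
    refine lt_of_mul_lt_mul_right ?_ (by linarith : 0 ≤ 1 + t)
    linarith
  have H4 := mul_lt_mul_of_pos_right H3 (by linarith : 0 < 1 + s)
  nlinarith

lemma false_of_weird {s t α β φ γ T a b e : ℝ} (hs : 0 < s) (ht : 0 < t)
    (hα : 0 < α) (hβ : 0 < β) (ha : 0 < a) (hb : 0 < b) (hda : α + s ≤ a)
    (hφ0 : 0 ≤ φ) (hγ0 : 0 ≤ γ) (hY : φ + γ < T)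
    (hφ : φ < s + 1) (hγ : 2 * γ < b) (hγ2 : t * b + 2 * γ ≤ b * b / 2)
    (he : e = T + t * a + s * b + a + b - φ - γ)
    (h1 : α * (e - (α + s) - t * a) ≤ β * (2 * φ + s * a + (α + s)))
    (h2 : β * (e - s * b) ≤ α * (2 * γ + t * b)) : False := by
  have H1 : α * (T - φ - γ + (s + 1) * b) ≤ β * (2 * φ + (s + 1) * a) := by
    subst he; nlinarith
  have H2 : β * (T - φ - γ + (t + 1) * a + b) ≤ α * (2 * γ + t * b) := by
    subst he; nlinarith
  obtain ⟨h, hh⟩ : ∃ h, 2 * γ + t * b = b * h := ⟨(2 * γ + t * b) / b, by field_simp⟩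
  rw [hh] at H2
  have hh1 : h ≤ t + 1 := by
    refine le_of_mul_le_mul_left ?_ hb
    linarith
  have hh2 : 2 * h ≤ b := by
    refine le_of_mul_le_mul_left ?_ hb
    linarith
  have hh0 : 0 < h := by
    refine pos_of_mul_pos_right (a := b) ?_ hb.le
    rw [← hh]; nlinarith
  have H1' : α * ((s + 1) * b) < β * (2 * φ + (s + 1) * a) :=
    lt_of_lt_of_le (mul_lt_mul_of_pos_left (by linarith) hα) H1
  have H2' : β * ((t + 1) * a + b) < α * (b * h) :=
    lt_of_lt_of_le (mul_lt_mul_of_pos_left (by linarith) hβ) H2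
  have H3 : α * ((s + 1) * b) * h < β * (2 * φ + (s + 1) * a) * h :=
    mul_lt_mul_of_pos_right H1' hh0
  have H4 : (s + 1) * (β * ((t + 1) * a + b)) < (s + 1) * (α * (b * h)) :=
    mul_lt_mul_of_pos_left H2' (by linarith)
  have H5 : β * ((s + 1) * ((t + 1) * a + b)) < β * ((2 * φ + (s + 1) * a) * h) := by linarith
  have H6 := lt_of_mul_lt_mul_left H5 hβ.le
  have h7 : 2 * φ * h ≤ (s + 1) * b := by nlinarith
  have h8 : (s + 1) * a * h ≤ (s + 1) * a * (t + 1) :=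
    mul_le_mul_of_nonneg_left hh1 (by positivity)
  nlinarith

end RealInequalities

section Triples

variable {V : Type*} [Fintype V] [DecidableEq V]

/-- No two disjoint nonempty sets have nonnegative excesses, except pairs covering all vertices
whose total excess is less than `T`. -/
def NoGoodPair (G : SimpleGraph V) (s t T : ℝ) : Prop :=
  ∀ A B : Finset V, A.Nonempty → B.Nonempty → Disjoint A B →
    0 ≤ excess G s A → 0 ≤ excess G t B → A ∪ B = univ ∧ excess G s A + excess G t B < T

/-- A partition `V = A ⊔ {v} ⊔ B` such that the excesses of `A` and `B` are below the thresholds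
`τ₁` and `τ₂` and increase when `v` is added. -/
structure AdmissibleTriple (G : SimpleGraph V) (s t τ₁ τ₂ : ℝ) (A : Finset V) (v : V)
    (B : Finset V) : Prop where
  notMem_left : v ∉ A
  notMem_right : v ∉ B
  disj : Disjoint A B
  cover : insert v (A ∪ B) = univ
  left_lt : excess G s A < τ₁
  right_lt : excess G t B < τ₂
  left_pos : s < degIn G A v
  right_pos : t < degIn G B v

/-- The functional maximised over admissible triples. -/
noncomputable def tripleGauge (G : SimpleGraph V) (s t τ₁ τ₂ : ℝ) (A : Finset V) (v : V)
    (B : Finset V) : ℝ :=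
  ((degIn G A v - s) + (degIn G B v - t)) *
    (1 - (τ₁ - excess G s A) / (degIn G A v - s) - (τ₂ - excess G t B) / (degIn G B v - t))

/-- An admissible triple with maximum gauge, the gauge being nonnegative. -/
structure ExtremalTriple (G : SimpleGraph V) (s t τ₁ τ₂ : ℝ) (A : Finset V) (v : V)
    (B : Finset V) : Prop extends AdmissibleTriple G s t τ₁ τ₂ A v B where
  gauge_nonneg : 0 ≤ tripleGauge G s t τ₁ τ₂ A v B
  gauge_le : ∀ A' v' B', AdmissibleTriple G s t τ₁ τ₂ A' v' B' →
    tripleGauge G s t τ₁ τ₂ A' v' B' ≤ tripleGauge G s t τ₁ τ₂ A v B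

variable {G : SimpleGraph V} {s t τ₁ τ₂ T : ℝ} {A B : Finset V} {v : V}

lemma NoGoodPair.symm (h : NoGoodPair G s t T) : NoGoodPair G t s T := by
  intro A B hA hB hd h1 h2
  have := h B A hB hA hd.symm h2 h1
  rwa [union_comm, add_comm]

lemma AdmissibleTriple.symm (h : AdmissibleTriple G s t τ₁ τ₂ A v B) :
    AdmissibleTriple G t s τ₂ τ₁ B v A :=
  ⟨h.notMem_right, h.notMem_left, h.disj.symm, by rw [union_comm, h.cover], h.right_lt, h.left_lt,
    h.right_pos, h.left_pos⟩

lemma tripleGauge_symm : tripleGauge G t s τ₂ τ₁ B v A = tripleGauge G s t τ₁ τ₂ A v B := by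
  unfold tripleGauge; ring

lemma ExtremalTriple.symm (h : ExtremalTriple G s t τ₁ τ₂ A v B) :
    ExtremalTriple G t s τ₂ τ₁ B v A :=
  ⟨h.toAdmissibleTriple.symm, by rw [tripleGauge_symm]; exact h.gauge_nonneg, fun A' v' B' h' => by
    rw [tripleGauge_symm (A := A), ← tripleGauge_symm]; exact h.gauge_le _ _ _ h'.symm⟩

lemma ExtremalTriple.theta_le_one (h : ExtremalTriple G s t τ₁ τ₂ A v B) :
    (τ₁ - excess G s A) / (degIn G A v - s) + (τ₂ - excess G t B) / (degIn G B v - t) ≤ 1 := by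
  have h1 := h.left_pos
  have h2 := h.right_pos
  have h3 := h.gauge_nonneg
  unfold tripleGauge at h3
  have := nonneg_of_mul_nonneg_right h3 (by linarith)
  linarith

lemma ExtremalTriple.left_le (h : ExtremalTriple G s t τ₁ τ₂ A v B) :
    τ₁ - excess G s A ≤ degIn G A v - s := by
  have h1 := h.left_pos
  have h2 := h.right_pos
  have h3 := h.theta_le_one
  have h4 : 0 ≤ (τ₂ - excess G t B) / (degIn G B v - t) :=
    div_nonneg (by linarith [h.right_lt]) (by linarith)
  exact (div_le_one (by linarith)).1 (by linarith)

lemma ExtremalTriple.two_le_card (h : ExtremalTriple G s t τ₁ τ₂ A v B) (hs : 1 / 2 < s)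
    (hτ₁ : 0 ≤ τ₁) : 1 < A.card := by
  have h1 := h.left_le
  have h2 := h.left_pos
  by_contra hc
  rcases (by omega : A.card = 0 ∨ A.card = 1) with h0 | h0
  · rw [card_eq_zero.1 h0] at h2
    simp only [degIn_empty] at h2
    linarith
  · obtain ⟨w, rfl⟩ := card_eq_one.1 h0
    have h3 := degIn_le_card G {w} v
    have h4 : excess G s {w} = -s := by simp [excess, degIn]
    rw [h4] at h1
    simp only [card_singleton, Nat.cast_one] at h3
    linarith

/-- Exchanging `v` with a vertex `u ∈ A` that would lift `B` to its threshold. -/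
lemma ExtremalTriple.exchange (h : ExtremalTriple G s t τ₁ τ₂ A v B) (hN : NoGoodPair G s t T)
    (hτ₁ : 0 ≤ τ₁) (hτ₂ : 0 ≤ τ₂) (hT : T ≤ τ₁ + τ₂) {u : V} (hu : u ∈ A)
    (hq : τ₂ - excess G t B ≤ degIn G B u - t) :
    excess G s A + (degIn G A v - s) - (degIn G A u + adjInd G u v - s) < τ₁ ∧
      (degIn G A v - s) * (degIn G B u - t)
        ≤ (degIn G B v - t) * (degIn G A u + adjInd G u v - s) := by
  have hvA := h.notMem_left
  have hvB := h.notMem_right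
  have huB : u ∉ B := disjoint_left.1 h.disj hu
  have huv : u ≠ v := fun e => hvA (e ▸ hu)
  have hv' : v ∉ A.erase u := fun e => hvA (mem_of_mem_erase e)
  have hmem : ∀ x, x = v ∨ x ∈ A ∨ x ∈ B := fun x => by
    have := mem_univ x
    rw [← h.cover] at this
    simpa using this
  have hdis := disjoint_left.1 h.disj
  have e1 : excess G s (insert v (A.erase u))
      = excess G s A + (degIn G A v - s) - (degIn G A u + adjInd G u v - s) := by
    rw [excess_insert G s hv', excess_erase G s hu, degIn_erase G hu, adjInd_comm G v u]; ring
  have e2 : excess G t (insert u B) = excess G t B + (degIn G B u - t) := excess_insert G t huB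
  have e3 : degIn G (insert v (A.erase u)) u = degIn G A u + adjInd G u v := by
    rw [degIn_insert G hv', degIn_erase G hu]; simp
  have hlt : excess G s (insert v (A.erase u)) < τ₁ := by
    by_contra hc
    push Not at hc
    have := (hN (insert v (A.erase u)) (insert u B) (insert_nonempty _ _) (insert_nonempty _ _)
      (by
        rw [disjoint_left]
        intro x hx hx'
        simp only [mem_insert, mem_erase] at hx hx'
        rcases hx with rfl | ⟨hx1, hx2⟩
        · rcases hx' with hx' | hx'
          · exact huv hx'.symm
          · exact hvB hx'
        · rcases hx' with hx' | hx'
          · exact hx1 hx'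
          · exact hdis hx2 hx')
      (by linarith) (by linarith)).2
    linarith
  have hp := h.left_le
  rw [e1] at hlt
  refine ⟨hlt, ?_⟩
  have hq0 := h.right_lt
  have hα := h.left_pos
  have hβ := h.right_pos
  have hadm : AdmissibleTriple G s t τ₁ τ₂ (insert v (A.erase u)) u B := by
    refine ⟨by simp [huv], huB, ?_, ?_, by rw [e1]; exact hlt, hq0, by rw [e3]; linarith,
      by linarith⟩
    · rw [disjoint_left]
      intro x hx hx'
      simp only [mem_insert, mem_erase] at hx
      rcases hx with rfl | ⟨hx1, hx2⟩
      · exact hvB hx'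
      · exact hdis hx2 hx'
    · ext x
      simp only [mem_insert, mem_union, mem_erase, mem_univ, iff_true]
      have := hmem x
      tauto
  have hg := h.gauge_le _ _ _ hadm
  unfold tripleGauge at hg
  rw [e1, e3] at hg
  refine div_le_div_of_gauge_le (p := τ₁ - excess G s A) (q := τ₂ - excess G t B)
    (by linarith) (by linarith) (by linarith) hp (by linarith) (by linarith) ?_
  convert hg using 4
  ring

/-- Moving a vertex `u ∈ A` that does not lift `B` to its threshold. -/
lemma ExtremalTriple.move (h : ExtremalTriple G s t τ₁ τ₂ A v B) (hN : NoGoodPair G s t T)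
    (hs : 1 / 2 < s) (hτ₁ : 0 ≤ τ₁) (hτ₂ : 0 ≤ τ₂) {u : V} (hu : u ∈ A)
    (hq : degIn G B u - t < τ₂ - excess G t B) :
    (degIn G A v - s) * (degIn G B u - t)
        ≤ (degIn G B v - t) * (degIn G A u - s + adjInd G u v *
          ((τ₁ - excess G s A) / (degIn G A v - s)
            + (τ₂ - excess G t B) / (degIn G B v - t))) := by
  have hvA := h.notMem_left
  have hvB := h.notMem_right
  have huB : u ∉ B := disjoint_left.1 h.disj hu
  have huv : u ≠ v := fun e => hvA (e ▸ hu)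
  have hmem : ∀ x, x = v ∨ x ∈ A ∨ x ∈ B := fun x => by
    have := mem_univ x
    rw [← h.cover] at this
    simpa using this
  have hdis := disjoint_left.1 h.disj
  have e1 : excess G s (A.erase u) = excess G s A - (degIn G A u - s) := excess_erase G s hu
  have e2 : excess G t (insert v B) = excess G t B + (degIn G B v - t) := excess_insert G t hvB
  have e3 : excess G t (insert u B) = excess G t B + (degIn G B u - t) := excess_insert G t huB
  have e4 : degIn G (A.erase u) v = degIn G A v - adjInd G u v := by
    rw [degIn_erase G hu, adjInd_comm]
  have e5 : degIn G (insert u B) v = degIn G B v + adjInd G u v := by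
    rw [degIn_insert G huB, adjInd_comm]
  have hle := h.left_le
  have hle' := h.symm.left_le
  have hα := h.left_pos
  have hβ := h.right_pos
  have hp := h.left_lt
  have hq0 := h.right_lt
  have hA2 := h.two_le_card hs hτ₁
  have hlt : excess G s (A.erase u) < 0 := by
    by_contra hc
    push Not at hc
    have := (hN (A.erase u) (insert v B)
      (card_pos.1 (by rw [card_erase_of_mem hu]; omega)) (insert_nonempty _ _)
      (by
        rw [disjoint_left]
        intro x hx hx'
        simp only [mem_insert, mem_erase] at hx hx'
        rcases hx' with rfl | hx'
        · exact hvA hx.2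
        · exact hdis hx.2 hx')
      hc (by linarith)).1
    have hu' : u ∈ A.erase u ∪ insert v B := this ▸ mem_univ u
    simp [huv, huB] at hu'
  have hadm : 0 < degIn G A v - s - adjInd G u v →
      AdmissibleTriple G s t τ₁ τ₂ (A.erase u) v (insert u B) := by
    intro hpos
    refine ⟨fun e => hvA (mem_of_mem_erase e), by simp [huv.symm, hvB], ?_, ?_, by linarith,
      by linarith, by linarith, by linarith [adjInd_nonneg G u v]⟩
    · rw [disjoint_left]
      intro x hx hx'
      simp only [mem_insert, mem_erase] at hx hx'
      rcases hx' with hx' | hx'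
      · exact hx.1 hx'
      · exact hdis hx.2 hx'
    · ext x
      simp only [mem_insert, mem_union, mem_erase, mem_univ, iff_true]
      have := hmem x
      tauto
  have hth : 0 < degIn G A v - s - adjInd G u v →
      (τ₁ - excess G s A) / (degIn G A v - s) + (τ₂ - excess G t B) / (degIn G B v - t) ≤
      (τ₁ - excess G s A + (degIn G A u - s)) / (degIn G A v - s - adjInd G u v)
        + (τ₂ - excess G t B - (degIn G B u - t)) / (degIn G B v - t + adjInd G u v) := by
    intro hpos
    have hg := h.gauge_le _ _ _ (hadm hpos)
    unfold tripleGauge at hg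
    rw [e1, e3, e4, e5, show degIn G A v - adjInd G u v - s + (degIn G B v + adjInd G u v - t)
      = degIn G A v - s + (degIn G B v - t) by ring] at hg
    have := le_of_mul_le_mul_left hg (by linarith)
    rw [show τ₁ - (excess G s A - (degIn G A u - s)) = τ₁ - excess G s A + (degIn G A u - s) by
      ring, show τ₂ - (excess G t B + (degIn G B u - t))
      = τ₂ - excess G t B - (degIn G B u - t) by ring, show degIn G A v - adjInd G u v - s
      = degIn G A v - s - adjInd G u v by ring, show degIn G B v + adjInd G u v - t
      = degIn G B v - t + adjInd G u v by ring] at this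
    linarith
  rcases adjInd_eq G u v with h0 | h1
  · rw [h0] at hth ⊢
    simp only [sub_zero, add_zero, zero_mul] at hth ⊢
    exact le_of_theta_le (by linarith) (by linarith) (hth (by linarith))
  · rw [h1] at hth ⊢
    rw [one_mul]
    exact le_of_theta_le_shift (by linarith) (by linarith) (by linarith) (by linarith)
      (by linarith) (by linarith) fun h2 => hth (by linarith)

/-- The local inequalities at an extremal triple, summed over `A`. -/
lemma ExtremalTriple.sum_bound (h : ExtremalTriple G s t τ₁ τ₂ A v B) (hN : NoGoodPair G s t T)
    (hs : 1 / 2 < s) (hτ₁ : 0 ≤ τ₁) (hτ₂ : 0 ≤ τ₂) (hT : T ≤ τ₁ + τ₂) {θ : ℝ}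
    (hθ : θ = (τ₁ - excess G s A) / (degIn G A v - s)
      + (τ₂ - excess G t B) / (degIn G B v - t)) :
    ∃ ζ : V → ℝ, (∀ u ∈ A, ζ u = 0 ∨ (ζ u = 1 ∧ adjInd G u v = 1 ∧
        τ₂ - excess G t B ≤ degIn G B u - t ∧
        excess G s A + (degIn G A v - s) - (degIn G A u + 1 - s) < τ₁)) ∧
      ∑ u ∈ A, ζ u ≤ degIn G A v ∧
      (degIn G A v - s) * (∑ u ∈ A, degIn G B u - t * A.card) ≤
        (degIn G B v - t) * (2 * excess G s A + s * A.card + ∑ u ∈ A, ζ u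
          + θ * (degIn G A v - ∑ u ∈ A, ζ u)) := by
  have hd : degIn G A v = ∑ u ∈ A, adjInd G u v :=
    sum_congr rfl fun _ _ => adjInd_comm G _ _
  refine ⟨fun u => if τ₂ - excess G t B ≤ degIn G B u - t then adjInd G u v else 0, ?_, ?_, ?_⟩
  · intro u hu
    rcases adjInd_eq G u v with h0 | h1
    · left; simp [h0]
    · by_cases hq : τ₂ - excess G t B ≤ degIn G B u - t
      · right
        have := (h.exchange hN hτ₁ hτ₂ hT hu hq).1
        rw [h1] at this
        exact ⟨by simp [hq, h1], h1, hq, this⟩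
      · left; simp [hq]
  · rw [hd]
    refine sum_le_sum fun u _ => ?_
    split_ifs
    · exact le_rfl
    · exact adjInd_nonneg G u v
  · have key : ∀ u ∈ A, (degIn G A v - s) * (degIn G B u - t) ≤
        (degIn G B v - t) * (degIn G A u - s
          + (if τ₂ - excess G t B ≤ degIn G B u - t then adjInd G u v else 0)
          + θ * (adjInd G u v
            - (if τ₂ - excess G t B ≤ degIn G B u - t then adjInd G u v else 0))) := by
      intro u hu
      split_ifs with hq
      · have := (h.exchange hN hτ₁ hτ₂ hT hu hq).2
        rw [sub_self, mul_zero, add_zero]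
        convert this using 2
        ring
      · have := h.move hN hs hτ₁ hτ₂ hu (not_le.1 hq)
        rw [← hθ] at this
        convert this using 2
        ring
    have := sum_le_sum key
    rw [← mul_sum, ← mul_sum] at this
    simp only [sum_add_distrib, sum_sub_distrib, ← mul_sum, sum_const, nsmul_eq_mul] at this
    rw [sum_degIn G s, ← hd] at this
    beta_reduce
    linarith

end Triples

section Contradiction

variable {V : Type*} [Fintype V] [DecidableEq V]
variable {G : SimpleGraph V} {s t τ₁ τ₂ T : ℝ} {A B : Finset V} {v : V}

lemma NoGoodPair.lt_degIn (hN : NoGoodPair G s t T) (hA : 1 < A.card) (hB : B.Nonempty)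
    (hd : Disjoint A B) (hg : 0 ≤ excess G t B) {w : V} (hw : w ∈ A) :
    s + excess G s A < degIn G A w := by
  by_contra hc
  push Not at hc
  have e := excess_erase G s hw
  have := (hN (A.erase w) B (card_pos.1 (by rw [card_erase_of_mem hw]; omega)) hB
    (hd.mono_left (erase_subset _ _)) (by linarith) hg).1
  have hw' : w ∈ A.erase w ∪ B := this ▸ mem_univ w
  simp [disjoint_left.1 hd hw] at hw'

lemma AdmissibleTriple.sum_degIn_eq (h : AdmissibleTriple G s t τ₁ τ₂ A v B) :
    ∑ u ∈ A, degIn G B u = excess G (s + t + 1) univ - excess G s A - excess G t B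
      + t * A.card + s * B.card - (degIn G A v - s) - (degIn G B v - t) + A.card + B.card + 1 := by
  have hv : v ∉ A ∪ B := by simp [h.notMem_left, h.notMem_right]
  have h1 := excess_union G s t h.disj
  have h2 := excess_insert G (s + t) hv
  rw [h.cover, degIn_union G h.disj] at h2
  have h3 : (univ : Finset V).card = A.card + B.card + 1 := by
    rw [← h.cover, card_insert_of_notMem hv, card_union_of_disjoint h.disj]
  have h4 : excess G (s + t + 1) univ = excess G (s + t) univ - (univ : Finset V).card := by
    unfold excess; ring
  rw [h3] at h4
  push_cast at h4
  linarith

lemma ExtremalTriple.false_of_nonneg (h : ExtremalTriple G s t T 0 A v B)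
    (hN : NoGoodPair G s t T) (hs : 1 / 2 < s) (ht : 1 / 2 < t) (hT : 0 ≤ T)
    (hTe : T = excess G (s + t + 1) univ) (hf : 0 ≤ excess G s A) : False := by
  have hα := h.left_pos
  have hβ := h.right_pos
  have hle' := h.symm.left_le
  have hA2 := h.two_le_card hs hT
  have hB2 := h.symm.two_le_card ht le_rfl
  have hvB := h.notMem_right
  have hvA := h.notMem_left
  have hAne : A.Nonempty := card_pos.1 (by omega)
  have hcB : (insert v B).card = B.card + 1 := card_insert_of_notMem hvB
  have hdis : Disjoint A (insert v B) := by
    rw [disjoint_insert_right]; exact ⟨hvA, h.disj⟩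
  have eγ : excess G t (insert v B) = excess G t B + (degIn G B v - t) := excess_insert G t hvB
  have hγ0 : 0 ≤ excess G t (insert v B) := by rw [eγ]; linarith
  have hY := (hN A (insert v B) hAne (insert_nonempty _ _) hdis hf hγ0).2
  have hdA : ∀ w ∈ A, s + excess G s A < degIn G A w := fun w hw =>
    hN.lt_degIn hA2 (insert_nonempty _ _) hdis hγ0 hw
  have hdB : ∀ w ∈ insert v B, t + excess G t (insert v B) < degIn G (insert v B) w :=
    fun w hw => hN.symm.lt_degIn (by omega) hAne hdis.symm hf hw
  have hsA := excess_small G (by linarith) hAne hf hdA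
  have hsB := excess_small G (by linarith) (insert_nonempty v B) hγ0 hdB
  obtain ⟨ζ, -, hζ2, hζ3⟩ := h.sum_bound hN hs hT le_rfl (by linarith) rfl
  have hθ1 := h.theta_le_one
  have hcard : (0 : ℝ) < A.card := by exact_mod_cast card_pos.2 hAne
  have hloc : ∀ w ∈ insert v B, (degIn G B v - t) * (degIn G A w - s)
      ≤ (degIn G A v - s) * (degIn G (insert v B) w - t) := by
    intro w hw
    have hbw := hdB w hw
    rcases le_or_gt (degIn G A w - s) 0 with h0 | h0
    · have h1 : (degIn G B v - t) * (degIn G A w - s) ≤ 0 :=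
        mul_nonpos_of_nonneg_of_nonpos (by linarith) h0
      have h2 : 0 ≤ (degIn G A v - s) * (degIn G (insert v B) w - t) :=
        mul_nonneg (by linarith) (by linarith)
      linarith
    · have e1 : excess G t ((insert v B).erase w)
          = excess G t (insert v B) - (degIn G (insert v B) w - t) := excess_erase G t hw
      have e2 : degIn G ((insert v B).erase w) w = degIn G (insert v B) w := by
        rw [degIn_erase G hw]; simp
      have hwA : w ∉ A := disjoint_right.1 hdis hw
      have hadm : AdmissibleTriple G s t T 0 A w ((insert v B).erase w) := by
        refine ⟨hwA, notMem_erase _ _, hdis.mono_right (erase_subset _ _), ?_, h.left_lt,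
          by linarith, by linarith, by linarith⟩
        rw [← union_insert, insert_erase hw, union_insert, h.cover]
      have hg := h.gauge_le _ _ _ hadm
      rw [← tripleGauge_symm, ← tripleGauge_symm (A := A) (v := v)] at hg
      unfold tripleGauge at hg
      rw [e1, e2] at hg
      refine div_le_div_of_gauge_le (p := 0 - excess G t B) (q := T - excess G s A)
        (by linarith) (by linarith) (by linarith [h.left_lt]) hle' (by linarith) h0 ?_
      convert hg using 4
      rw [eγ]; ring
  have hsum := sum_le_sum hloc
  rw [← mul_sum, ← mul_sum] at hsum
  simp only [sum_sub_distrib, sum_const, nsmul_eq_mul] at hsum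
  rw [sum_degIn G t] at hsum
  have he := h.sum_degIn_eq
  have he2 : ∑ w ∈ insert v B, degIn G A w = ∑ u ∈ A, degIn G B u + degIn G A v := by
    rw [sum_insert hvB, sum_degIn_comm G A B]; ring
  have hcB' : ((insert v B).card : ℝ) = B.card + 1 := by rw [hcB]; push_cast; ring
  refine false_of_weird (s := s) (t := t) (α := degIn G A v - s) (β := degIn G B v - t)
    (φ := excess G s A) (γ := excess G t (insert v B)) (T := T) (a := A.card)
    (b := (insert v B).card) (e := ∑ w ∈ insert v B, degIn G A w)
    (by linarith) (by linarith) (by linarith) (by linarith) hcard (by rw [hcB']; positivity)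
    (by linarith [degIn_le_card G A v]) hf hγ0 hY hsA.2.1 hsB.1 hsB.2.2 ?_ ?_ ?_
  · rw [he2, he, eγ, hcB', ← hTe]; ring
  · rw [he2]
    have h1 : ∑ u ∈ A, ζ u + ((T - excess G s A) / (degIn G A v - s)
        + (0 - excess G t B) / (degIn G B v - t)) * (degIn G A v - ∑ u ∈ A, ζ u)
        ≤ degIn G A v := by nlinarith
    have h2 := mul_le_mul_of_nonneg_left h1 (by linarith : 0 ≤ degIn G B v - t)
    linarith
  · linarith

lemma ExtremalTriple.false_of_neg (h : ExtremalTriple G s t T 0 A v B)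
    (hN : NoGoodPair G s t T) (hs : 1 / 2 < s) (ht : 1 / 2 < t) (hT : 0 ≤ T)
    (hTe : T = excess G (s + t + 1) univ) (hf : excess G s A < 0)
    (hαβ : T * (degIn G B v - t) ≤ T * (degIn G A v - s)) : False := by
  have hα := h.left_pos
  have hβ := h.right_pos
  have hg := h.right_lt
  have hA2 := h.two_le_card hs hT
  have hvB := h.notMem_right
  have hvA := h.notMem_left
  have hdis := disjoint_left.1 h.disj
  have hθ1 := h.theta_le_one
  obtain ⟨ζ, hζ1, hζ2, hζ3⟩ := h.sum_bound hN hs hT le_rfl (by linarith) rfl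
  obtain ⟨η, hη1, hη2, hη3⟩ := h.symm.sum_bound hN.symm ht le_rfl hT (by linarith) rfl
  have he := h.sum_degIn_eq
  have hsA := sum_degIn G s A
  have hsB := sum_degIn G t B
  have hdA := degIn_le_card G A v
  have hdB := degIn_le_card G B v
  rw [sum_degIn_comm G B A] at hη3
  rw [add_comm ((0 - excess G t B) / (degIn G B v - t))] at hη3
  generalize hθ : (T - excess G s A) / (degIn G A v - s)
    + (0 - excess G t B) / (degIn G B v - t) = θ at hθ1 hζ3 hη3
  have hα0 : 0 < degIn G A v - s := by linarith
  have hβ0 : 0 < degIn G B v - t := by linarith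
  have hpθ : T - excess G s A ≤ θ * (degIn G A v - s) := by
    rw [← hθ, add_mul, div_mul_cancel₀ _ hα0.ne']
    have : 0 ≤ (0 - excess G t B) / (degIn G B v - t) * (degIn G A v - s) :=
      mul_nonneg (div_nonneg (by linarith) hβ0.le) hα0.le
    linarith
  have hqθ : - excess G t B ≤ θ * (degIn G B v - t) := by
    rw [← hθ, add_mul, div_mul_cancel₀ _ hβ0.ne']
    have : 0 ≤ (T - excess G s A) / (degIn G A v - s) * (degIn G B v - t) :=
      mul_nonneg (div_nonneg (by linarith) hα0.le) hβ0.le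
    linarith
  have k2 : (∑ u ∈ B, η u) * (1 - θ) + θ * t - (-excess G t B)
      ≤ 1 + 2 * t + (B.card - degIn G B v) := by
    refine bracket_le (d := degIn G B v) (by linarith) hη2 (by linarith) (by linarith) hβ hqθ hθ1
      ?_
    have : ∑ u ∈ B, η u * (degIn G B v - 1 - (-excess G t B)) ≤ ∑ u ∈ B, degIn G B u := by
      refine sum_le_sum fun u hu => ?_
      rcases hη1 u hu with h0 | ⟨h1, -, -, h2⟩
      · rw [h0, zero_mul]; exact degIn_nonneg G B u
      · rw [h1]; linarith
    rw [← sum_mul] at this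
    linarith
  have k1 : (∑ u ∈ A, ζ u) * (1 - θ) + θ * s - (-excess G s A)
      ≤ 1 + 2 * s + (A.card - degIn G A v) := by
    by_cases hw : ∃ u ∈ A, ζ u = 1 ∧
        0 ≤ excess G s A + (degIn G A v - s) - (degIn G A u + 1 - s)
    · obtain ⟨u, hu, hu1, hu0⟩ := hw
      obtain ⟨-, hadj, huq, -⟩ := (hζ1 u hu).resolve_left (by rw [hu1]; norm_num)
      have huB : u ∉ B := hdis hu
      have huv : u ≠ v := fun e => hvA (e ▸ hu)
      have hv' : v ∉ A.erase u := fun e => hvA (mem_of_mem_erase e)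
      have e1 : excess G s (insert v (A.erase u))
          = excess G s A + (degIn G A v - s) - (degIn G A u + 1 - s) := by
        rw [excess_insert G s hv', excess_erase G s hu, degIn_erase G hu, adjInd_comm G v u, hadj]
        ring
      have e2 := excess_insert G t huB
      have hlow : ∀ w ∈ A, w ≠ u → s - 1 ≤ degIn G A w := by
        intro w hw hwu
        have hw' : w ∈ insert v (A.erase u) := by simp [hw, hwu]
        have := hN.lt_degIn (A := insert v (A.erase u)) (B := insert u B)
          (by rw [card_insert_of_notMem hv', card_erase_of_mem hu]; omega) (insert_nonempty _ _)
          (by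
            rw [disjoint_left]
            intro x hx hx'
            simp only [mem_insert, mem_erase] at hx hx'
            rcases hx with rfl | ⟨hx1, hx2⟩
            · rcases hx' with hx' | hx'
              · exact huv hx'.symm
              · exact hvB hx'
            · rcases hx' with hx' | hx'
              · exact hx1 hx'
              · exact hdis hx2 hx')
          (by linarith) hw'
        rw [degIn_insert G hv', degIn_erase G hu] at this
        linarith [adjInd_nonneg G w u, adjInd_le_one G w v]
      refine bracket_le_of_degrees (d := degIn G A v) (p := T - excess G s A) (by linarith) hζ2
        (by linarith) (by linarith) (by linarith) hα hpθ hθ1 ?_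
      have : ∑ w ∈ A, (ζ w * (degIn G A v - 1 - (T - excess G s A)) + (1 - ζ w) * (s - 1))
          ≤ ∑ w ∈ A, degIn G A w := by
        refine sum_le_sum fun w hw => ?_
        rcases hζ1 w hw with h0 | ⟨h1, -, -, h2⟩
        · have := hlow w hw (by rintro rfl; rw [hu1] at h0; norm_num at h0)
          rw [h0]; linarith
        · rw [h1]; linarith
      rw [sum_add_distrib, ← sum_mul, ← sum_mul, sum_sub_distrib, sum_const, nsmul_eq_mul,
        mul_one] at this
      linarith
    · push Not at hw
      refine bracket_le (d := degIn G A v) (by linarith) hζ2 (by linarith) (by linarith) hα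
        (by linarith) hθ1 ?_
      have : ∑ u ∈ A, ζ u * (degIn G A v - 1 - (-excess G s A)) ≤ ∑ u ∈ A, degIn G A u := by
        refine sum_le_sum fun u hu => ?_
        rcases hζ1 u hu with h0 | ⟨h1, -, -, -⟩
        · rw [h0, zero_mul]; exact degIn_nonneg G A u
        · have := hw u hu h1
          rw [h1]; linarith
      rw [← sum_mul] at this
      linarith
  refine false_of_strict (s := s) (t := t) (α := degIn G A v - s) (β := degIn G B v - t)
    (Θ := T) (π := -excess G s A) (q := -excess G t B) (θ := θ)
    (x := A.card - (degIn G A v - s)) (y := B.card - (degIn G B v - t))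
    (z := ∑ u ∈ A, ζ u) (w := ∑ u ∈ B, η u) (e := ∑ u ∈ A, degIn G B u)
    (by linarith) (by linarith) hα0 hβ0 hT (by linarith) (by linarith) ?_ (by linarith)
    (by linarith) ?_ ?_ ?_ (by linarith) (by linarith) hαβ
  · rw [← hθ]; ring
  · rw [he, ← hTe]; ring
  · linarith
  · linarith

end Contradiction

section Rounding

variable {V : Type*} [Fintype V] (G : SimpleGraph V)

/-- The quadratic extension of the excess to fractional sets. -/
noncomputable def fracExcess (s : ℝ) (x : V → ℝ) : ℝ :=
  (∑ u, x u * ∑ w, adjInd G u w * x w) / 2 + (∑ u, x u * x u) / 2 - (s + 1 / 2) * ∑ u, x u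

lemma fracExcess_add (s δ : ℝ) (x h : V → ℝ) :
    fracExcess G s (fun z => x z + δ * h z) = fracExcess G s x
      + δ * ∑ z, h z * (∑ w, adjInd G z w * x w + x z - (s + 1 / 2))
      + δ ^ 2 * ((∑ u, h u * ∑ w, adjInd G u w * h w) / 2 + (∑ u, h u * h u) / 2) := by
  have hc : ∑ u, x u * ∑ w, adjInd G u w * h w = ∑ u, h u * ∑ w, adjInd G u w * x w := by
    simp only [mul_sum]
    rw [sum_comm]
    refine sum_congr rfl fun a _ => sum_congr rfl fun b _ => ?_
    rw [adjInd_comm G b a]; ring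
  have e1 : ∑ u, (x u + δ * h u) * ∑ w, adjInd G u w * (x w + δ * h w)
      = ∑ u, x u * ∑ w, adjInd G u w * x w + 2 * δ * ∑ u, h u * ∑ w, adjInd G u w * x w
        + δ ^ 2 * ∑ u, h u * ∑ w, adjInd G u w * h w := by
    have : ∀ u, (x u + δ * h u) * ∑ w, adjInd G u w * (x w + δ * h w)
        = x u * ∑ w, adjInd G u w * x w + δ * (x u * ∑ w, adjInd G u w * h w)
          + δ * (h u * ∑ w, adjInd G u w * x w)
          + δ ^ 2 * (h u * ∑ w, adjInd G u w * h w) := by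
      intro u
      have : ∑ w, adjInd G u w * (x w + δ * h w)
          = ∑ w, adjInd G u w * x w + δ * ∑ w, adjInd G u w * h w := by
        rw [mul_sum, ← sum_add_distrib]
        exact sum_congr rfl fun _ _ => by ring
      rw [this]; ring
    simp only [this, sum_add_distrib, ← mul_sum]
    rw [hc]; ring
  have e2 : ∑ u, (x u + δ * h u) * (x u + δ * h u)
      = ∑ u, x u * x u + 2 * δ * ∑ u, h u * x u + δ ^ 2 * ∑ u, h u * h u := by
    simp only [mul_sum, ← sum_add_distrib]
    exact sum_congr rfl fun _ _ => by ring
  have e3 : ∑ u, (x u + δ * h u) = ∑ u, x u + δ * ∑ u, h u := by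
    rw [mul_sum, ← sum_add_distrib]
  have e4 : ∑ z, h z * (∑ w, adjInd G z w * x w + x z - (s + 1 / 2))
      = ∑ u, h u * ∑ w, adjInd G u w * x w + ∑ u, h u * x u - (s + 1 / 2) * ∑ u, h u := by
    rw [mul_sum, ← sum_add_distrib, ← sum_sub_distrib]
    exact sum_congr rfl fun _ _ => by ring
  unfold fracExcess
  rw [e1, e2, e3, e4]; ring

variable [DecidableEq V]

lemma fracExcess_indicator (s : ℝ) (A : Finset V) :
    fracExcess G s (fun z => if z ∈ A then 1 else 0) = excess G s A := by
  unfold fracExcess excess degIn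
  simp only [mul_ite, mul_one, mul_zero, ite_mul, one_mul, zero_mul, sum_ite_mem, univ_inter,
    inter_self, sum_const, nsmul_eq_mul]
  ring

lemma fracExcess_indicator_add (s y : ℝ) {A : Finset V} {v : V} (hv : v ∉ A) :
    fracExcess G s (fun z => (if z ∈ A then 1 else 0) + y * (if z = v then 1 else 0))
      = excess G s A + y * (degIn G A v - s - (1 - y) / 2) := by
  rw [fracExcess_add, fracExcess_indicator]
  unfold degIn
  simp [hv]
  ring

/-- One rounding step: shift weight between two fractional coordinates until one of them becomes
integral, decreasing neither extension. -/
lemma exists_rounding_step {s t : ℝ} (hc : ∀ u, 0 < degIn G univ u - s - t)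
    {x : V → ℝ} (hx0 : ∀ u, 0 ≤ x u) (hx1 : ∀ u, x u ≤ 1)
    (hx : 1 < (univ.filter fun u => 0 < x u ∧ x u < 1).card) :
    ∃ x' : V → ℝ, (∀ u, 0 ≤ x' u) ∧ (∀ u, x' u ≤ 1) ∧
      (univ.filter fun u => 0 < x' u ∧ x' u < 1).card
        < (univ.filter fun u => 0 < x u ∧ x u < 1).card ∧
      fracExcess G s x ≤ fracExcess G s x' ∧
      fracExcess G t (fun u => 1 - x u) ≤ fracExcess G t (fun u => 1 - x' u) := by
  set c : V → ℝ := fun u => degIn G univ u - s - t with hcdef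
  set φ : V → ℝ := fun z => ∑ w, adjInd G z w * x w + x z - (s + 1 / 2) with hφ
  obtain ⟨u, w, huw, hu, hw, hle⟩ : ∃ u w, u ≠ w ∧ (0 < x u ∧ x u < 1) ∧ (0 < x w ∧ x w < 1) ∧
      φ w / c w ≤ φ u / c u := by
    obtain ⟨u, hu, w, hw, huw⟩ := one_lt_card.1 hx
    simp only [mem_filter, mem_univ, true_and] at hu hw
    rcases le_total (φ w / c w) (φ u / c u) with h | h
    · exact ⟨u, w, huw, hu, hw, h⟩
    · exact ⟨w, u, huw.symm, hw, hu, h⟩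
  have hcu : 0 < c u := hc u
  have hcw : 0 < c w := hc w
  set h : V → ℝ := fun z => (if z = u then 1 / c u else 0) - (if z = w then 1 / c w else 0)
    with hh
  have hsum : ∀ ψ : V → ℝ, ∑ z, h z * ψ z = ψ u / c u - ψ w / c w := by
    intro ψ
    simp only [hh, sub_mul, ite_mul, zero_mul, sum_sub_distrib, sum_ite_eq', mem_univ, if_true]
    ring
  have hsum' : ∀ z, ∑ y, adjInd G z y * h y = adjInd G z u / c u - adjInd G z w / c w := by
    intro z
    rw [← hsum]
    exact sum_congr rfl fun _ _ => mul_comm _ _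
  have hhu : h u = 1 / c u := by simp [hh, huw]
  have hhw : h w = -(1 / c w) := by simp [hh, huw.symm]
  have hQ : 0 ≤ (∑ z, h z * ∑ y, adjInd G z y * h y) / 2 + (∑ z, h z * h z) / 2 := by
    rw [hsum, hsum, hsum', hsum', hhu, hhw, adjInd_comm G w u]
    simp only [adjInd_self]
    have h1 : 0 < 1 / c u := by positivity
    have h2 : 0 < 1 / c w := by positivity
    have : (0 / c u - adjInd G u w / c w) / c u - (adjInd G u w / c u - 0 / c w) / c w
        = - 2 * adjInd G u w * (1 / c u) * (1 / c w) := by ring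
    rw [this]
    have e : 1 / c u / c u - -(1 / c w) / c w = (1 / c u) ^ 2 + (1 / c w) ^ 2 := by ring
    rw [e]
    rcases adjInd_eq G u w with h0 | h0 <;> rw [h0] <;>
      nlinarith [sq_nonneg (1 / c u - 1 / c w), sq_nonneg (1 / c u), sq_nonneg (1 / c w)]
  set δ := min (c u * (1 - x u)) (c w * x w) with hδ
  have hδ0 : 0 < δ := lt_min (mul_pos hcu (by linarith)) (mul_pos hcw hw.1)
  have hδu : δ / c u ≤ 1 - x u := by
    rw [div_le_iff₀ hcu]; linarith [min_le_left (c u * (1 - x u)) (c w * x w)]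
  have hδw : δ / c w ≤ x w := by
    rw [div_le_iff₀ hcw]; linarith [min_le_right (c u * (1 - x u)) (c w * x w)]
  have hδu0 : 0 < δ / c u := div_pos hδ0 hcu
  have hδw0 : 0 < δ / c w := div_pos hδ0 hcw
  have hxu : x u + δ * h u = x u + δ / c u := by rw [hhu]; ring
  have hxw : x w + δ * h w = x w - δ / c w := by rw [hhw]; ring
  have hxz : ∀ z, z ≠ u → z ≠ w → x z + δ * h z = x z := by
    intro z h1 h2
    simp [hh, h1, h2]
  refine ⟨fun z => x z + δ * h z, ?_, ?_, ?_, ?_, ?_⟩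
  · intro z
    beta_reduce
    by_cases h1 : z = u
    · subst h1; rw [hxu]; linarith
    · by_cases h2 : z = w
      · subst h2; rw [hxw]; linarith
      · rw [hxz z h1 h2]; exact hx0 z
  · intro z
    beta_reduce
    by_cases h1 : z = u
    · subst h1; rw [hxu]; linarith
    · by_cases h2 : z = w
      · subst h2; rw [hxw]; linarith
      · rw [hxz z h1 h2]; exact hx1 z
  · refine card_lt_card ?_
    rw [ssubset_iff_of_subset]
    · rcases min_choice (c u * (1 - x u)) (c w * x w) with hm | hm
      · refine ⟨u, by simp [hu], ?_⟩
        have : δ / c u = 1 - x u := by rw [hδ, hm]; field_simp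
        simp only [mem_filter, mem_univ, true_and, hxu, this]
        intro h'; linarith [h'.2]
      · refine ⟨w, by simp [hw], ?_⟩
        have : δ / c w = x w := by rw [hδ, hm]; field_simp
        simp only [mem_filter, mem_univ, true_and, hxw, this]
        intro h'; linarith [h'.1]
    · intro z hz
      simp only [mem_filter, mem_univ, true_and] at hz ⊢
      by_cases h1 : z = u
      · subst h1; exact hu
      · by_cases h2 : z = w
        · subst h2; exact hw
        · rwa [hxz z h1 h2] at hz
  · rw [fracExcess_add, hsum]
    have h1 : 0 ≤ δ * (φ u / c u - φ w / c w) := mul_nonneg hδ0.le (by linarith)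
    have h2 := mul_nonneg (sq_nonneg δ) hQ
    simp only [hφ] at h1
    linarith
  · have e1 : (fun z => 1 - (x z + δ * h z)) = fun z => (1 - x z) + (-δ) * h z := by
      funext z; ring
    rw [e1, fracExcess_add, hsum]
    have hψ : ∀ z, ∑ y, adjInd G z y * (1 - x y) + (1 - x z) - (t + 1 / 2) = c z - φ z := by
      intro z
      simp only [hφ, hcdef, degIn, mul_sub, mul_one, sum_sub_distrib]
      ring
    rw [hψ, hψ, sub_div (c u), sub_div (c w), div_self hcu.ne', div_self hcw.ne']
    have h1 : 0 ≤ δ * (φ u / c u - φ w / c w) := mul_nonneg hδ0.le (by linarith)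
    have h2 := mul_nonneg (sq_nonneg δ) hQ
    rw [neg_sq]
    linarith

lemma exists_rounding {s t : ℝ} (hc : ∀ u, 0 < degIn G univ u - s - t)
    {x : V → ℝ} (hx0 : ∀ u, 0 ≤ x u) (hx1 : ∀ u, x u ≤ 1) :
    ∃ x' : V → ℝ, (∀ u, 0 ≤ x' u) ∧ (∀ u, x' u ≤ 1) ∧
      (univ.filter fun u => 0 < x' u ∧ x' u < 1).card ≤ 1 ∧
      fracExcess G s x ≤ fracExcess G s x' ∧
      fracExcess G t (fun u => 1 - x u) ≤ fracExcess G t (fun u => 1 - x' u) := by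
  induction hn : (univ.filter fun u => 0 < x u ∧ x u < 1).card using Nat.strong_induction_on
    generalizing x with
  | _ n ih =>
    rcases le_or_gt n 1 with h1 | h1
    · exact ⟨x, hx0, hx1, by omega, le_rfl, le_rfl⟩
    · obtain ⟨y, hy0, hy1, hy2, hy3, hy4⟩ := exists_rounding_step G hc hx0 hx1 (by omega)
      obtain ⟨z, hz0, hz1, hz2, hz3, hz4⟩ := ih _ (hn ▸ hy2) hy0 hy1 rfl
      exact ⟨z, hz0, hz1, hz2, hy3.trans hz3, hy4.trans hz4⟩

variable {G}

lemma NoGoodPair.left_lt {s t T τ₁ τ₂ y : ℝ} {A B : Finset V} {v : V} (hN : NoGoodPair G s t T)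
    (hs : 0 < s) (ht : 0 < t) (hτ₁ : 0 ≤ τ₁) (hτ₂ : 0 ≤ τ₂) (hT : T ≤ τ₁ + τ₂)
    (hvA : v ∉ A) (hvB : v ∉ B) (hd : Disjoint A B) (hy0 : 0 < y) (hy1 : y < 1)
    (h1 : τ₁ < excess G s A + y * (degIn G A v - s - (1 - y) / 2))
    (h2 : τ₂ < excess G t B + (1 - y) * (degIn G B v - t - y / 2)) :
    excess G s A < τ₁ := by
  by_contra hc
  push Not at hc
  have hA : A.Nonempty := by
    rw [nonempty_iff_ne_empty]
    rintro rfl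
    simp only [excess_empty, degIn_empty] at h1
    nlinarith
  rcases lt_or_ge (excess G t B) τ₂ with hB | hB
  · have h3 : 0 < degIn G B v - t - y / 2 := by
      refine pos_of_mul_pos_right (a := 1 - y) (by linarith) (by linarith)
    have h4 := excess_insert G t hvB
    have h5 : τ₂ ≤ excess G t (insert v B) := by rw [h4]; nlinarith
    have := (hN A (insert v B) hA (insert_nonempty _ _)
      (by rw [disjoint_insert_right]; exact ⟨hvA, hd⟩) (by linarith) (by linarith)).2
    linarith
  · have hBne : B.Nonempty := by
      rw [nonempty_iff_ne_empty]
      rintro rfl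
      simp only [excess_empty, degIn_empty] at h2
      nlinarith
    have := (hN A B hA hBne hd (by linarith) (by linarith)).1
    have hv : v ∈ A ∪ B := this ▸ mem_univ v
    simp [hvA, hvB] at hv

lemma NoGoodPair.exists_admissibleTriple {s t T τ₁ τ₂ : ℝ} (hN : NoGoodPair G s t T)
    (hs : 0 < s) (ht : 0 < t) (hτ₁ : 0 ≤ τ₁) (hτ₂ : 0 ≤ τ₂) (hT : T ≤ τ₁ + τ₂)
    (hc : ∀ u, 0 < degIn G univ u - s - t) {x : V → ℝ} (hx0 : ∀ u, 0 ≤ x u) (hx1 : ∀ u, x u ≤ 1)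
    (h1 : τ₁ < fracExcess G s x) (h2 : τ₂ < fracExcess G t (fun u => 1 - x u)) :
    ∃ A v B, AdmissibleTriple G s t τ₁ τ₂ A v B ∧ 0 ≤ tripleGauge G s t τ₁ τ₂ A v B := by
  obtain ⟨y, hy0, hy1, hy2, hy3, hy4⟩ := exists_rounding G hc hx0 hx1
  replace h1 := h1.trans_le hy3
  replace h2 := h2.trans_le hy4
  set A := univ.filter fun u => y u = 1 with hA
  set B := univ.filter fun u => y u = 0 with hB
  have hdis : Disjoint A B := by
    rw [disjoint_left]
    intro z hz hz'
    simp only [hA, hB, mem_filter, mem_univ, true_and] at hz hz'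
    linarith
  rcases (by omega : (univ.filter fun u => 0 < y u ∧ y u < 1).card = 0
    ∨ (univ.filter fun u => 0 < y u ∧ y u < 1).card = 1) with h0 | h0
  · exfalso
    rw [card_eq_zero, filter_eq_empty_iff] at h0
    have h01 : ∀ z, y z = 0 ∨ y z = 1 := by
      intro z
      by_contra hcon
      push Not at hcon
      exact h0 (mem_univ z) ⟨lt_of_le_of_ne (hy0 z) hcon.1.symm, lt_of_le_of_ne (hy1 z) hcon.2⟩
    have e1 : y = fun z => if z ∈ A then 1 else 0 := by
      funext z
      rcases h01 z with h | h <;> simp [hA, h]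
    have e2 : (fun u => 1 - y u) = fun z => if z ∈ B then 1 else 0 := by
      funext z
      rcases h01 z with h | h <;> simp [hB, h]
    rw [e2, fracExcess_indicator] at h2
    have h1' : τ₁ < excess G s A := by
      rw [← fracExcess_indicator, ← e1]; exact h1
    have hAne : A.Nonempty := by
      rw [nonempty_iff_ne_empty]
      intro he
      rw [he, excess_empty] at h1'
      linarith
    have hBne : B.Nonempty := by
      rw [nonempty_iff_ne_empty]
      intro he
      rw [he, excess_empty] at h2
      linarith
    have := (hN A B hAne hBne hdis (by linarith) (by linarith)).2
    linarith
  · obtain ⟨v, hv⟩ := card_eq_one.1 h0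
    have hvf : 0 < y v ∧ y v < 1 := by
      have : v ∈ univ.filter fun u => 0 < y u ∧ y u < 1 := by rw [hv]; simp
      simpa using this
    have h01 : ∀ z, z ≠ v → y z = 0 ∨ y z = 1 := by
      intro z hz
      by_contra hcon
      push Not at hcon
      have : z ∈ univ.filter fun u => 0 < y u ∧ y u < 1 := by
        simp only [mem_filter, mem_univ, true_and]
        exact ⟨lt_of_le_of_ne (hy0 z) hcon.1.symm, lt_of_le_of_ne (hy1 z) hcon.2⟩
      rw [hv, mem_singleton] at this
      exact hz this
    have hvA : v ∉ A := by
      simp only [hA, mem_filter, mem_univ, true_and]; exact hvf.2.ne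
    have hvB : v ∉ B := by
      simp only [hB, mem_filter, mem_univ, true_and]; exact hvf.1.ne'
    obtain ⟨r, hr⟩ : ∃ r, r = y v := ⟨_, rfl⟩
    rw [← hr] at hvf
    have e1 : y = fun z => (if z ∈ A then 1 else 0) + r * (if z = v then 1 else 0) := by
      funext z
      by_cases hz : z = v
      · subst hz; simp [hvA, hr]
      · rcases h01 z hz with h | h <;> simp [hA, h, hz]
    have e2 : (fun u => 1 - y u)
        = fun z => (if z ∈ B then 1 else 0) + (1 - r) * (if z = v then 1 else 0) := by
      funext z
      by_cases hz : z = v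
      · subst hz; simp [hvB, hr]
      · rcases h01 z hz with h | h <;> simp [hB, h, hz]
    rw [e2, fracExcess_indicator_add G t (1 - r) hvB] at h2
    have h1' : τ₁ < excess G s A + r * (degIn G A v - s - (1 - r) / 2) := by
      rw [← fracExcess_indicator_add G s r hvA, ← e1]; exact h1
    rw [sub_sub_cancel] at h2
    have hf := hN.left_lt hs ht hτ₁ hτ₂ hT hvA hvB hdis hvf.1 hvf.2 h1' h2
    have hg := hN.symm.left_lt (y := 1 - r) ht hs hτ₂ hτ₁ (by linarith) hvB hvA hdis.symm
      (by linarith) (by linarith) (by rw [sub_sub_cancel]; exact h2)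
      (by rw [sub_sub_cancel]; exact h1')
    have hα : 0 < degIn G A v - s := by
      have := pos_of_mul_pos_right (a := r) (b := degIn G A v - s - (1 - r) / 2) (by linarith)
        hvf.1.le
      linarith
    have hβ : 0 < degIn G B v - t := by
      have := pos_of_mul_pos_right (a := 1 - r) (b := degIn G B v - t - r / 2) (by linarith)
        (by linarith)
      linarith
    refine ⟨A, v, B, ⟨hvA, hvB, hdis, ?_, hf, hg, by linarith, by linarith⟩, ?_⟩
    · ext z
      simp only [mem_insert, mem_union, mem_univ, iff_true, hA, hB, mem_filter, true_and]
      by_cases hz : z = v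
      · exact Or.inl hz
      · exact Or.inr (h01 z hz).symm
    · unfold tripleGauge
      have h3 : (τ₁ - excess G s A) / (degIn G A v - s) ≤ r := by
        rw [div_le_iff₀ hα]; nlinarith
      have h4 : (τ₂ - excess G t B) / (degIn G B v - t) ≤ 1 - r := by
        rw [div_le_iff₀ hβ]; nlinarith
      exact mul_nonneg (by linarith) (by linarith)

end Rounding

section Existence

/-- The numerical inequalities behind the constant fractional set from which the rounding
starts. -/
lemma exists_start_weight {s t T n : ℝ} (ht : 0 < t) (hts : t ≤ s) (hn : 0 < n) (hT : 0 ≤ T)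
    (hTn : 2 * T ≤ n) :
    ∃ p, 0 ≤ p ∧ p ≤ 1 ∧ T < p * (p * (T + (s + t + 1) * n + n / 2) - (s + 1 / 2) * n) ∧
      0 < (1 - p) * ((1 - p) * (T + (s + t + 1) * n + n / 2) - (t + 1 / 2) * n) := by
  obtain ⟨h, hh⟩ : ∃ h, h = 1 / 2 + T / n := ⟨_, rfl⟩
  obtain ⟨ε, hε⟩ : ∃ ε, ε = 1 / (2 * (s + 3)) := ⟨_, rfl⟩
  have hε0 : 0 < ε := by rw [hε]; exact div_pos one_pos (by linarith)
  have hε1 : ε * (s + 3) = 1 / 2 := by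
    rw [hε]; have : s + 3 ≠ 0 := by linarith
    field_simp
  have hε2 : ε < 1 / 2 := by nlinarith
  have hTe : T = n * (h - 1 / 2) := by rw [hh]; field_simp; ring
  have h0 : 1 / 2 ≤ h := by rw [hh]; have := div_nonneg hT hn.le; linarith
  have h1 : h ≤ 1 := by
    have : n * (h - 1 / 2) ≤ n * (1 / 2) := by linarith
    linarith [le_of_mul_le_mul_left this hn]
  have hk : 0 < s + t + 1 + h := by linarith
  have hm : T + (s + t + 1) * n + n / 2 = n * (s + t + 1 + h) := by rw [hTe]; ring
  have hp : 1 - (s + 1 / 2 + h - ε) / (s + t + 1 + h) = (t + 1 / 2 + ε) / (s + t + 1 + h) := by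
    field_simp; ring
  have hq : 0 < (t + 1 / 2 + ε) / (s + t + 1 + h) := div_pos (by linarith) hk
  refine ⟨(s + 1 / 2 + h - ε) / (s + t + 1 + h), (div_pos (by linarith) hk).le, by linarith, ?_, ?_⟩
  · have e : (s + 1 / 2 + h - ε) / (s + t + 1 + h) *
        ((s + 1 / 2 + h - ε) / (s + t + 1 + h) * (n * (s + t + 1 + h)) - (s + 1 / 2) * n)
        = n * ((s + 1 / 2 + h - ε) * (h - ε) / (s + t + 1 + h)) := by
      field_simp; ring
    rw [hm, e, hTe]
    refine mul_lt_mul_of_pos_left ?_ hn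
    rw [lt_div_iff₀ hk]
    have h2 : h * t ≤ t := by nlinarith
    have h3 : ε * (s + 1 / 2 + 2 * h) ≤ ε * (s + 3) - ε / 2 := by nlinarith
    nlinarith [sq_nonneg ε]
  · rw [hp, hm]
    have e : (t + 1 / 2 + ε) / (s + t + 1 + h) *
        ((t + 1 / 2 + ε) / (s + t + 1 + h) * (n * (s + t + 1 + h)) - (t + 1 / 2) * n)
        = (t + 1 / 2 + ε) / (s + t + 1 + h) * (n * ε) := by
      field_simp; ring
    rw [e]
    positivity

variable {V : Type*} [Fintype V]

lemma fracExcess_const (G : SimpleGraph V) (s p σ : ℝ) :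
    fracExcess G s (fun _ => p) = p * (p * (excess G σ univ + σ * Fintype.card V
      + Fintype.card V / 2) - (s + 1 / 2) * Fintype.card V) := by
  unfold fracExcess excess degIn
  simp only [← sum_mul, ← mul_sum, sum_const, card_univ, nsmul_eq_mul]
  ring

variable [DecidableEq V] {G : SimpleGraph V} {s t T : ℝ}

lemma ExtremalTriple.false {A B : Finset V} {v : V} (h : ExtremalTriple G s t T 0 A v B)
    (h' : ∀ A' v' B', AdmissibleTriple G s t 0 T A' v' B' →
      tripleGauge G s t 0 T A' v' B' ≤ tripleGauge G s t T 0 A v B)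
    (hN : NoGoodPair G s t T) (hs : 1 / 2 < s) (ht : 1 / 2 < t) (hT : 0 ≤ T)
    (hTe : T = excess G (s + t + 1) univ) : False := by
  rcases le_or_gt 0 (excess G s A) with hf | hf
  · exact h.false_of_nonneg hN hs ht hT hTe hf
  refine h.false_of_neg hN hs ht hT hTe hf ?_
  have hα := h.left_pos
  have hβ := h.right_pos
  have hg := h' A v B ⟨h.notMem_left, h.notMem_right, h.disj, h.cover, hf,
    h.right_lt.trans_le hT, h.left_pos, h.right_pos⟩
  unfold tripleGauge at hg
  have hg := le_of_mul_le_mul_left hg (by linarith)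
  simp only [sub_div, zero_div] at hg
  have : T / (degIn G A v - s) ≤ T / (degIn G B v - t) := by linarith
  rwa [div_le_div_iff₀ (by linarith) (by linarith)] at this

/-- If all proper nonempty sets have negative `(s + t + 1)`-excess, then a good pair exists. -/
theorem not_noGoodPair_of_minimal [Nonempty V] (hs : 1 / 2 < s) (ht : 1 / 2 < t)
    (hT : 0 ≤ excess G (s + t + 1) univ)
    (hmin : ∀ X : Finset V, X.Nonempty → X ≠ univ → excess G (s + t + 1) X < 0) :
    ¬ NoGoodPair G s t (excess G (s + t + 1) univ) := by
  wlog hts : t ≤ s generalizing s t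
  · have e : s + t + 1 = t + s + 1 := by ring
    rw [e] at hT hmin ⊢
    exact fun hN => this ht hs hT hmin (le_of_not_ge hts) hN.symm
  intro hN
  obtain ⟨T, hTe⟩ : ∃ T, T = excess G (s + t + 1) univ := ⟨_, rfl⟩
  rw [← hTe] at hT hN
  have hd : ∀ v, s + t + 1 + T < degIn G univ v := by
    intro v
    have he := excess_erase G (s + t + 1) (mem_univ v)
    rcases (univ.erase v).eq_empty_or_nonempty with h0 | h0
    · have h1 : degIn G univ v = 0 := by
        have := degIn_erase G (mem_univ v) v
        rw [h0] at this
        simpa using this.symm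
      rw [h0, excess_empty, h1] at he
      linarith
    · have := hmin _ h0 (erase_ssubset (mem_univ v)).ne
      linarith
  have hsmall := excess_small G (s := s + t + 1) (by linarith) univ_nonempty (by linarith)
    (fun w _ => by rw [← hTe]; exact hd w)
  rw [← hTe, card_univ] at hsmall
  obtain ⟨p, hp0, hp1, hp2, hp3⟩ := exists_start_weight (s := s) (t := t) (T := T)
    (n := Fintype.card V) (by linarith) hts (by exact_mod_cast Fintype.card_pos) hT hsmall.1.le
  rw [hTe, ← fracExcess_const, ← hTe] at hp2
  rw [hTe, ← fracExcess_const] at hp3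
  obtain ⟨A₀, v₀, B₀, hadm, hgauge⟩ := hN.exists_admissibleTriple (τ₁ := T) (τ₂ := 0)
    (by linarith) (by linarith) hT le_rfl (by linarith) (fun u => by linarith [hd u])
    (fun _ => hp0) (fun _ => hp1) hp2 hp3
  classical
  let P : Bool × Finset V × V × Finset V → Prop := fun q =>
    AdmissibleTriple G s t (if q.1 then T else 0) (if q.1 then 0 else T) q.2.1 q.2.2.1 q.2.2.2
  let φ : Bool × Finset V × V × Finset V → ℝ := fun q =>
    tripleGauge G s t (if q.1 then T else 0) (if q.1 then 0 else T) q.2.1 q.2.2.1 q.2.2.2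
  have h₀ : (true, A₀, v₀, B₀) ∈ univ.filter P := by simpa [P] using hadm
  obtain ⟨⟨b, A, v, B⟩, hq, hmax⟩ := exists_max_image (univ.filter P) φ ⟨_, h₀⟩
  rw [mem_filter] at hq
  have hφ0 : 0 ≤ φ (b, A, v, B) := le_trans (by simpa [φ] using hgauge) (hmax _ h₀)
  have m1 : ∀ A' v' B', AdmissibleTriple G s t T 0 A' v' B' →
      tripleGauge G s t T 0 A' v' B' ≤ φ (b, A, v, B) := fun A' v' B' ha => by
    simpa [φ] using hmax (true, A', v', B') (by simpa [P] using ha)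
  have m2 : ∀ A' v' B', AdmissibleTriple G s t 0 T A' v' B' →
      tripleGauge G s t 0 T A' v' B' ≤ φ (b, A, v, B) := fun A' v' B' ha => by
    simpa [φ] using hmax (false, A', v', B') (by simpa [P] using ha)
  have hP := hq.2
  cases b
  · simp only [P, φ, Bool.false_eq_true, if_false] at hP hφ0 m1 m2
    have hE : ExtremalTriple G s t 0 T A v B := ⟨hP, hφ0, m2⟩
    refine hE.symm.false ?_ hN.symm ht hs hT (by rw [hTe]; congr 1; ring)
    intro A' v' B' ha
    rw [tripleGauge_symm (A := A) (B := B), ← tripleGauge_symm]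
    exact m1 _ _ _ ha.symm
  · simp only [P, φ, if_true] at hP hφ0 m1 m2
    have hE : ExtremalTriple G s t T 0 A v B := ⟨hP, hφ0, m1⟩
    exact hE.false m2 hN hs ht hT hTe

end Existence

section Transfer

variable {V : Type*} (G : SimpleGraph V)

lemma edgesIn_sub_eq_excess [Fintype V] (s : ℝ) (A : Finset V) :
    (G.edgesIn A : ℝ) - s * A.card = excess G s A := by
  classical
  let H : SimpleGraph V :=
    { Adj := fun u w => G.Adj u w ∧ u ∈ A ∧ w ∈ A
      symm := ⟨fun _ _ h => ⟨h.1.symm, h.2.2, h.2.1⟩⟩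
      loopless := ⟨fun _ h => G.loopless.irrefl _ h.1⟩ }
  have hE : {e ∈ G.edgeSet | ∀ v ∈ e, v ∈ A} = H.edgeSet := by
    ext e
    induction e using Sym2.ind with
    | _ a b => simp [H]
  have hd : ∀ u, (H.degree u : ℝ) = if u ∈ A then degIn G A u else 0 := by
    intro u
    rw [← SimpleGraph.card_neighborFinset_eq_degree, SimpleGraph.neighborFinset_eq_filter]
    split_ifs with hu
    · unfold degIn adjInd
      rw [sum_boole]
      congr 2
      ext w
      simp [H, hu, and_comm]
    · simp [H, hu]
  have hsum := H.sum_degrees_eq_twice_card_edges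
  have hcard : G.edgesIn A = H.edgeFinset.card := by
    unfold SimpleGraph.edgesIn
    rw [hE, ← SimpleGraph.coe_edgeFinset, Set.ncard_coe_finset]
  have hsum' : ∑ u ∈ A, degIn G A u = 2 * (H.edgeFinset.card : ℝ) := by
    rw [← Nat.cast_ofNat, ← Nat.cast_mul, ← hsum, Nat.cast_sum]
    simp only [hd, sum_ite_mem, univ_inter]
  unfold excess
  rw [hcard, hsum']
  ring

lemma excess_map_subtype (s : ℝ) {p : V → Prop} (A : Finset (Subtype p)) :
    excess (G.comap Subtype.val) s A = excess G s (A.map (Function.Embedding.subtype p)) := by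
  unfold excess degIn
  rw [sum_map, card_map]
  simp only [sum_map]
  rfl

end Transfer

/-- If `s, t > 1/2` and `‖V‖ - (s+t+1)|V| ≥ 0`, then there exist disjoint nonempty sets
`A`, `B` with `‖A‖ - s|A| ≥ 0`, `‖B‖ - t|B| ≥ 0` and
`(‖A‖ - s|A|) + (‖B‖ - t|B|) ≥ T(A ∪ B) - 1`, where
`T(X) = max {0, ‖X‖ - (s+t+1)|X|}`. -/
theorem avg_degree_partition_strong {V : Type*} [Fintype V] [Nonempty V] [DecidableEq V]
    (G : SimpleGraph V) (s t : ℝ) (hs : 1 / 2 < s) (ht : 1 / 2 < t)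
    (h : 0 ≤ (G.edgesIn Finset.univ : ℝ) - (s + t + 1) * (Fintype.card V : ℝ)) :
    ∃ A B : Finset V, A.Nonempty ∧ B.Nonempty ∧ Disjoint A B ∧
      0 ≤ (G.edgesIn A : ℝ) - s * A.card ∧
      0 ≤ (G.edgesIn B : ℝ) - t * B.card ∧
      max 0 ((G.edgesIn (A ∪ B) : ℝ) - (s + t + 1) * (A ∪ B).card) - 1 ≤
        ((G.edgesIn A : ℝ) - s * A.card) + ((G.edgesIn B : ℝ) - t * B.card) := by
  simp only [edgesIn_sub_eq_excess]
  rw [← card_univ, edgesIn_sub_eq_excess] at h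
  obtain ⟨X, hX, hXmin⟩ := exists_min_image
    (univ.filter fun X : Finset V => X.Nonempty ∧ 0 ≤ excess G (s + t + 1) X) card
    ⟨univ, by simp [univ_nonempty, h]⟩
  simp only [mem_filter, mem_univ, true_and] at hX hXmin
  obtain ⟨hXne, hX0⟩ := hX
  have hlt : ∀ Y ⊆ X, Y.Nonempty → Y ≠ X → excess G (s + t + 1) Y < 0 := by
    intro Y hY hYne hYX
    by_contra hc
    exact absurd (hXmin Y ⟨hYne, not_lt.1 hc⟩)
      (not_le.2 (card_lt_card (hY.ssubset_of_ne hYX)))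
  have hsub : ∀ Y : Finset {x // x ∈ X}, Y.map (Function.Embedding.subtype _) ⊆ X := by
    intro Y y hy
    obtain ⟨z, -, rfl⟩ := mem_map.1 hy
    exact z.2
  have huniv : (univ : Finset {x // x ∈ X}).map (Function.Embedding.subtype _) = X := by
    rw [univ_eq_attach, attach_map_val]
  have hmapX : ∀ Y : Finset {x // x ∈ X},
      Y.map (Function.Embedding.subtype _) = X → Y = univ := by
    intro Y hY
    exact map_injective _ (hY.trans huniv.symm)
  have : Nonempty {x // x ∈ X} := hXne.to_subtype
  have key := not_noGoodPair_of_minimal (G := G.comap (Subtype.val : {x // x ∈ X} → V)) hs ht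
    (by rw [excess_map_subtype, huniv]; exact hX0) (by
      intro Y hY hYu
      rw [excess_map_subtype]
      exact hlt _ (hsub Y) (hY.map) fun he => hYu (hmapX Y he))
  unfold NoGoodPair at key
  push Not at key
  obtain ⟨A, B, hA, hB, hd, hf, hg, hAB⟩ := key
  simp only [excess_map_subtype, huniv] at hf hg hAB
  refine ⟨A.map (Function.Embedding.subtype _), B.map (Function.Embedding.subtype _), hA.map,
    hB.map, (disjoint_map _).2 hd, hf, hg, ?_⟩
  rw [← map_union]
  by_cases hu : A ∪ B = univ
  · rw [hu, huniv, max_eq_right hX0]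
    linarith [hAB hu]
  · rw [max_eq_left (hlt _ (hsub _) ((hA.mono subset_union_left).map)
      fun he => hu (hmapX _ he)).le]
    linarith
end
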